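/- Let M ≥ 1, let x₁ < x₂ < ⋯ < x_M and y₁ < y₂ < ⋯ < y_M be real numbers, and let 𝓕_ReLU = {x ↦ v·max(wx + b, 0) : v, w, b ∈ ℝ} be the one-dimensional ReLU control family. Then there exists a function ψ in the attainable set A_{𝓕_ReLU} such that ψ(x_i) = y_i for all i = 1, …, M. -/

import Mathlib

open MeasureTheory Set

noncomputable section

/-- `φ` is the time-`τ` flow map of the ODE `ż = f(z)`, `z(0) = x`. -/
def IsFlowMap {E : Type*} [NormedAddCommGroup E] [NormedSpace ℝ E]
    (f : E → E) (τ : ℝ) (φ : E → E) : Prop :=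
  ∀ x : E, ∃ z : ℝ → E, z 0 = x ∧ (∀ t : ℝ, HasDerivAt z (f (z t)) t) ∧ φ x = z τ

/-- The attainable set `A_𝓕`: all finite compositions
`φ_{τ_k}^{f_k} ∘ ⋯ ∘ φ_{τ_1}^{f_1}` of flow maps of members of `𝓕` (`k ≥ 1`, `τ_i ≥ 0`). -/
def Attainable {E : Type*} [NormedAddCommGroup E] [NormedSpace ℝ E]
    (F : Set (E → E)) : Set (E → E) :=
  { φ | ∃ L : List ((E → E) × ℝ × (E → E)), L ≠ [] ∧
      (∀ q ∈ L, q.1 ∈ F ∧ 0 ≤ q.2.1 ∧ IsFlowMap q.1 q.2.1 q.2.2) ∧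
      φ = L.foldl (fun g q => q.2.2 ∘ g) id }

/-- The time-`T` attainable set `A_𝓕(T)`: compositions of flow maps with total
time horizon `T`. -/
def AttainableT {E : Type*} [NormedAddCommGroup E] [NormedSpace ℝ E]
    (F : Set (E → E)) (T : ℝ) : Set (E → E) :=
  { φ | ∃ L : List ((E → E) × ℝ × (E → E)), L ≠ [] ∧
      (∀ q ∈ L, q.1 ∈ F ∧ 0 ≤ q.2.1 ∧ IsFlowMap q.1 q.2.1 q.2.2) ∧
      (L.map fun q => q.2.1).sum = T ∧
      φ = L.foldl (fun g q => q.2.2 ∘ g) id }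

/-- Approximation closure: closure in the topology of compact convergence. -/
def ApproxClosure {α β : Type*} [TopologicalSpace α] [NormedAddCommGroup β]
    (A : Set (α → β)) : Set (α → β) :=
  { φ | ∀ K : Set α, IsCompact K → ∀ ε > 0, ∃ ψ ∈ A, ∀ x ∈ K, ‖φ x - ψ x‖ ≤ ε }

/-- A scalar well function on `ℝⁿ`: a Lipschitz function whose zero set is squeezed
between a nonempty bounded open convex set and its closure. -/
def IsWellFunctionScalar {n : ℕ} (h : (Fin n → ℝ) → ℝ) : Prop :=
  (∃ L, LipschitzWith L h) ∧
  ∃ Ω : Set (Fin n → ℝ), Ω.Nonempty ∧ IsOpen Ω ∧ Convex ℝ Ω ∧ Bornology.IsBounded Ω ∧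
    Ω ⊆ { x | h x = 0 } ∧ { x | h x = 0 } ⊆ closure Ω

/-- A (vector-valued) well function on `ℝⁿ`: each component is a scalar well function. -/
def IsWellFunction {n : ℕ} (h : (Fin n → ℝ) → (Fin n → ℝ)) : Prop :=
  ∀ i, IsWellFunctionScalar (fun x => h x i)

/-- A well function on `ℝ`: a Lipschitz function whose zero set is squeezed between a
nonempty bounded open interval and its closure. -/
def IsWellFunction1 (h : ℝ → ℝ) : Prop :=
  (∃ L, LipschitzWith L h) ∧
  ∃ a b : ℝ, a < b ∧ Ioo a b ⊆ { x | h x = 0 } ∧ { x | h x = 0 } ⊆ Icc a b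

/-- Restricted affine invariance: `𝓕` is closed under `f ↦ x ↦ D f(Ax + b)` where `D`, `A`
are diagonal, the entries of `D` are `±1` or `0`, and the entries of `A` are `≤ 1`. -/
def RestrictedAffineInvariant {n : ℕ} (F : Set ((Fin n → ℝ) → (Fin n → ℝ))) : Prop :=
  ∀ f ∈ F, ∀ D A : Fin n → ℝ, ∀ b : Fin n → ℝ,
    (∀ i, D i = 1 ∨ D i = -1 ∨ D i = 0) → (∀ i, A i ≤ 1) →
    (fun x i => D i * f (fun j => A j * x j + b j) i) ∈ F

/-- The one-dimensional ReLU control family `{x ↦ v·ReLU(wx + b)}`. -/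
def ReLUFamily1 : Set (ℝ → ℝ) :=
  { f | ∃ v w b : ℝ, f = fun x => v * max (w * x + b) 0 }

/-- The time-one map of `ż = v * max (z - c) 0`. -/
def reluFlow (c v x : ℝ) : ℝ := x + (Real.exp v - 1) * max (x - c) 0

theorem reluFlow_of_le {c x : ℝ} (v : ℝ) (h : x ≤ c) : reluFlow c v x = x := by
  simp [reluFlow, h]

theorem reluFlow_of_ge {c x : ℝ} (v : ℝ) (h : c ≤ x) :
    reluFlow c v x = c + Real.exp v * (x - c) := by
  rw [reluFlow, max_eq_left (sub_nonneg.2 h)]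
  ring

theorem strictMono_reluFlow (c v : ℝ) : StrictMono (reluFlow c v) := by
  intro a b hab
  have he := Real.exp_pos v
  rcases le_total b c with hb | hb
  · rwa [reluFlow_of_le v hb, reluFlow_of_le v (hab.le.trans hb)]
  · rw [reluFlow_of_ge v hb]
    rcases le_total a c with ha | ha
    · rw [reluFlow_of_le v ha]
      rcases hb.eq_or_lt with rfl | hb
      · simpa using hab
      · nlinarith [mul_pos he (sub_pos.2 hb)]
    · rw [reluFlow_of_ge v ha]
      gcongr

theorem isFlowMap_reluFlow (c v : ℝ) :
    IsFlowMap (fun z : ℝ => v * max (1 * z + -c) 0) 1 (reluFlow c v) := by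
  intro x
  refine ⟨fun t => reluFlow c (v * t) x, by simp [reluFlow], fun t => ?_, by simp⟩
  have hd : HasDerivAt (fun s => Real.exp (v * s)) (Real.exp (v * t) * v) t := by
    simpa using ((hasDerivAt_id t).const_mul v).exp
  rcases le_total x c with h | h
  · simpa [reluFlow_of_le _ h, h] using hasDerivAt_const t x
  · simp only [reluFlow_of_ge _ h]
    have hp : 0 ≤ Real.exp (v * t) * (x - c) := mul_nonneg (Real.exp_pos _).le (sub_nonneg.2 h)
    rw [max_eq_left (by linarith)]
    convert (hd.mul_const (x - c)).const_add c using 1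
    ring

theorem isFlowMap_translation (s : ℝ) :
    IsFlowMap (fun z : ℝ => s * max (0 * z + 1) 0) 1 (fun x => x + s) := by
  intro x
  refine ⟨fun t => x + s * t, by simp, fun t => ?_, by simp⟩
  simpa using ((hasDerivAt_id t).const_mul s).const_add x

theorem mem_attainable_of_isFlowMap {E : Type*} [NormedAddCommGroup E] [NormedSpace ℝ E]
    {F : Set (E → E)} {f φ : E → E} {τ : ℝ} (hf : f ∈ F) (hτ : 0 ≤ τ) (hφ : IsFlowMap f τ φ) :
    φ ∈ Attainable F :=
  ⟨[(f, τ, φ)], by simp, by simpa using ⟨hf, hτ, hφ⟩, by simp⟩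

theorem comp_mem_attainable_of_isFlowMap {E : Type*} [NormedAddCommGroup E] [NormedSpace ℝ E]
    {F : Set (E → E)} {f φ ψ : E → E} {τ : ℝ} (hψ : ψ ∈ Attainable F) (hf : f ∈ F)
    (hτ : 0 ≤ τ) (hφ : IsFlowMap f τ φ) : φ ∘ ψ ∈ Attainable F := by
  obtain ⟨L, -, hL, rfl⟩ := hψ
  refine ⟨L ++ [(f, τ, φ)], by simp, fun q hq => ?_, by simp [List.foldl_append]⟩
  rcases List.mem_append.1 hq with hq | hq
  · exact hL q hq
  · obtain rfl := List.mem_singleton.1 hq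
    exact ⟨hf, hτ, hφ⟩

theorem exists_strictMono_attainable_interpolation (n : ℕ) (x y : Fin (n + 1) → ℝ)
    (hx : StrictMono x) (hy : StrictMono y) :
    ∃ ψ ∈ Attainable ReLUFamily1, StrictMono ψ ∧ ∀ i, ψ (x i) = y i := by
  induction n with
  | zero =>
    refine ⟨fun z => z + (y 0 - x 0),
      mem_attainable_of_isFlowMap ⟨y 0 - x 0, 0, 1, rfl⟩ zero_le_one (isFlowMap_translation _),
      fun a b h => by simpa using h, fun i => ?_⟩
    obtain rfl : i = 0 := Fin.fin_one_eq_zero i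
    ring
  | succ n ih =>
    obtain ⟨ψ, hψ, hmono, hval⟩ := ih (x ∘ Fin.castSucc) (y ∘ Fin.castSucc)
      (hx.comp Fin.strictMono_castSucc) (hy.comp Fin.strictMono_castSucc)
    set c := y (Fin.last n).castSucc
    have h₁ : c < y (Fin.last (n + 1)) := hy (Fin.castSucc_lt_last _)
    have h₂ : c < ψ (x (Fin.last (n + 1))) := by
      have h := hmono (hx (Fin.castSucc_lt_last (Fin.last n)))
      rwa [show ψ (x (Fin.last n).castSucc) = c from hval (Fin.last n)] at h
    set v := Real.log ((y (Fin.last (n + 1)) - c) / (ψ (x (Fin.last (n + 1))) - c)) with hv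
    refine ⟨reluFlow c v ∘ ψ,
      comp_mem_attainable_of_isFlowMap hψ ⟨v, 1, -c, rfl⟩ zero_le_one (isFlowMap_reluFlow c v),
      (strictMono_reluFlow c v).comp hmono, fun i => ?_⟩
    refine Fin.lastCases ?_ (fun j => ?_) i
    · rw [Function.comp_apply, reluFlow_of_ge v h₂.le, hv,
        Real.exp_log (div_pos (sub_pos.2 h₁) (sub_pos.2 h₂)),
        div_mul_cancel₀ _ (sub_pos.2 h₂).ne']
      ring
    · rw [Function.comp_apply, show ψ (x j.castSucc) = y j.castSucc from hval j]
      exact reluFlow_of_le v (hy.monotone (Fin.castSucc_le_castSucc_iff.2 (Fin.le_last j)))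

/-- **Finite interpolation by ReLU-driven flows in 1D.** Given `x₁ < ⋯ < x_M` and
`y₁ < ⋯ < y_M`, some map in the attainable set of the ReLU family sends each `xᵢ` to `yᵢ`. -/
theorem relu_flow_interpolation
    (M : ℕ) (hM : 1 ≤ M)
    (x y : Fin M → ℝ) (hx : StrictMono x) (hy : StrictMono y) :
    ∃ ψ ∈ Attainable ReLUFamily1, ∀ i, ψ (x i) = y i := by
  obtain ⟨n, rfl⟩ := Nat.exists_eq_add_of_le' hM
  obtain ⟨ψ, hψ, -, hval⟩ := exists_strictMono_attainable_interpolation n x y hx hy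
  exact ⟨ψ, hψ, hval⟩
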